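/- arXiv:1912.07676 — 2 statements merged into one kernel-verified Lean document; each statement's English description precedes it below -/
import Mathlib

section
/- Assume (A1), (A2), (A4), (A5), (A7)'' (α_φ c_φ² < m_A), and (A8). Then there exists a unique element u ∈ K such that ⟨A u, v − u⟩ + φ(γ_φ u, γ_φ v) − φ(γ_φ u, γ_φ u) ≥ ⟨f, v − u⟩ for all v ∈ K. -/
open Filter Topology Bornology

/-- The generalized (Clarke) directional derivative of `ψ` at `x` in the direction `v`:
`ψ⁰(x; v) = limsup_{y → x, t ↓ 0} (ψ(y + t v) − ψ(y))/t`. -/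
noncomputable def clarkeDeriv {Y : Type*} [NormedAddCommGroup Y] [NormedSpace ℝ Y]
    (ψ : Y → ℝ) (x v : Y) : ℝ :=
  Filter.limsup (fun p : Y × ℝ => (ψ (p.1 + p.2 • v) - ψ p.1) / p.2)
    ((𝓝 x) ×ˢ (𝓝[>] (0 : ℝ)))

/-- The generalized (Clarke) subdifferential:
`∂ψ(x) = {ζ ∈ Y* : ψ⁰(x; v) ≥ ⟨ζ, v⟩ for all v ∈ Y}`. -/
def clarkeSubdiff {Y : Type*} [NormedAddCommGroup Y] [NormedSpace ℝ Y]
    (ψ : Y → ℝ) (x : Y) : Set (Y →L[ℝ] ℝ) :=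
  {ζ | ∀ v : Y, ζ v ≤ clarkeDeriv ψ x v}

/-- Weak convergence of a sequence in a normed space: `⟨g, uₙ⟩ → ⟨g, u⟩` for all `g ∈ Y*`. -/
def WeakTendsto {Y : Type*} [NormedAddCommGroup Y] [NormedSpace ℝ Y]
    (u : ℕ → Y) (w : Y) : Prop :=
  ∀ g : Y →L[ℝ] ℝ, Tendsto (fun n => g (u n)) atTop (𝓝 (g w))

/-- An operator `A : Y → Y*` is bounded if it maps bounded sets to bounded sets. -/
def BoundedOperator {Y : Type*} [NormedAddCommGroup Y] [NormedSpace ℝ Y]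
    (A : Y → Y →L[ℝ] ℝ) : Prop :=
  ∀ s : Set Y, IsBounded s → IsBounded (A '' s)

/-- `A : Y → Y*` is pseudomonotone: it is bounded, and whenever `uₙ ⇀ u` weakly and
`limsupₙ ⟨A uₙ, uₙ − u⟩ ≤ 0`, one has
`⟨A u, u − v⟩ ≤ liminfₙ ⟨A uₙ, uₙ − v⟩` for all `v`. -/
def Pseudomonotone {Y : Type*} [NormedAddCommGroup Y] [NormedSpace ℝ Y]
    (A : Y → Y →L[ℝ] ℝ) : Prop :=
  BoundedOperator A ∧
  ∀ (u : ℕ → Y) (w : Y), WeakTendsto u w →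
    Filter.limsup (fun n => A (u n) (u n - w)) atTop ≤ 0 →
    ∀ v : Y, A w (w - v) ≤ Filter.liminf (fun n => A (u n) (u n - v)) atTop

/-- `P : Y → Y*` is a penalty operator for the set `K`: `P` is bounded, demicontinuous,
monotone, and `Ker(P) = K`. -/
def IsPenaltyOperator {Y : Type*} [NormedAddCommGroup Y] [NormedSpace ℝ Y]
    (P : Y → Y →L[ℝ] ℝ) (K : Set Y) : Prop :=
  BoundedOperator P ∧
  (∀ (u : ℕ → Y) (w : Y), Tendsto u atTop (𝓝 w) →
    ∀ v : Y, Tendsto (fun n => P (u n) v) atTop (𝓝 (P w v))) ∧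
  (∀ v₁ v₂ : Y, 0 ≤ (P v₁ - P v₂) (v₁ - v₂)) ∧
  {v : Y | P v = 0} = K

/-- A real normed space is reflexive if the canonical embedding into the double dual
is surjective. -/
def IsReflexive (Y : Type*) [NormedAddCommGroup Y] [NormedSpace ℝ Y] : Prop :=
  Function.Surjective (NormedSpace.inclusionInDoubleDual ℝ Y)

/-- A finite family version of Minty's trick: if `G x y + G y x ≤ 0` and every `G x` is convex and
lower semicontinuous, then finitely many inequalities `G v u ≤ 0` have a common solution `u` in the
convex hull of the parameters `v`. -/
theorem exists_mem_convexHull_forall_nonpos {E : Type*} [AddCommGroup E] [Module ℝ E]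
    [TopologicalSpace E] [IsTopologicalAddGroup E] [ContinuousSMul ℝ E]
    {G : E → E → ℝ} (hcv : ∀ v, ConvexOn ℝ Set.univ (G v))
    (hlsc : ∀ v, LowerSemicontinuous (G v)) (hmono : ∀ x y, G x y + G y x ≤ 0)
    {s : Finset E} (hs : s.Nonempty) :
    ∃ u ∈ convexHull ℝ (s : Set E), ∀ v ∈ s, G v u ≤ 0 := by
  classical
  have : Nonempty s := hs.to_subtype
  have hcomb : ∀ w ∈ stdSimplex ℝ s, ConvexOn ℝ Set.univ (fun x => ∑ i : s, w i * G i x) := by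
    intro w hw
    refine ⟨convex_univ, fun x _ y _ p q hp hq hpq => ?_⟩
    simp only [smul_eq_mul, Finset.mul_sum, ← Finset.sum_add_distrib]
    refine Finset.sum_le_sum fun i _ => ?_
    have h := mul_le_mul_of_nonneg_left
      ((hcv i).2 (Set.mem_univ x) (Set.mem_univ y) hp hq hpq) (hw.1 i)
    simp only [smul_eq_mul] at h
    linarith
  obtain ⟨a, ha, b, hb, hab⟩ := Sion.exists_isSaddlePointOn
    (X := convexHull ℝ (s : Set E)) (Y := stdSimplex ℝ s)
    (f := fun x w => ∑ i : s, w i * G i x)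
    ((convexHull_nonempty_iff).2 hs) (convex_convexHull ℝ _)
    (s.finite_toSet.isCompact_convexHull ℝ)
    (fun w hw => by
      refine LowerSemicontinuous.lowerSemicontinuousOn (lowerSemicontinuous_sum fun i _ => ?_) _
      exact (continuous_const_mul (w i)).comp_lowerSemicontinuous (hlsc i)
        (fun x y h => mul_le_mul_of_nonneg_left h (hw.1 i)))
    (fun w hw => ((hcomb w hw).subset (Set.subset_univ _) (convex_convexHull ℝ _)).quasiconvexOn)
    (convex_stdSimplex ℝ s) ⟨_, single_mem_stdSimplex ℝ (Classical.arbitrary s)⟩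
    (isCompact_stdSimplex ℝ s)
    (fun x _ => (by fun_prop : Continuous fun w : s → ℝ =>
      ∑ i : s, w i * G i x).upperSemicontinuous.upperSemicontinuousOn _)
    (fun x _ => by
      refine ConcaveOn.quasiconcaveOn ⟨convex_stdSimplex ℝ s, fun w _ w' _ p q _ _ _ => ?_⟩
      refine le_of_eq ?_
      simp only [Pi.add_apply, Pi.smul_apply, smul_eq_mul, Finset.mul_sum, add_mul,
        Finset.sum_add_distrib, mul_assoc])
  refine ⟨a, ha, fun v hv => ?_⟩
  have hmem : ∑ i : s, b i • (i : E) ∈ convexHull ℝ (s : Set E) :=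
    (convex_convexHull ℝ _).sum_mem (fun i _ => hb.1 i) hb.2
      (fun i _ => subset_convexHull ℝ _ i.2)
  have h := hab _ hmem _ (single_mem_stdSimplex ℝ (⟨v, hv⟩ : s))
  have hval : ∑ i : s, (Pi.single (⟨v, hv⟩ : s) (1 : ℝ) : s → ℝ) i * G i a = G v a := by
    simp [Pi.single_apply]
  beta_reduce at h
  rw [hval] at h
  have hjensen : ∀ i : s, G i (∑ j : s, b j • (j : E)) ≤ ∑ j : s, b j * G i j := fun i =>
    (hcv i).map_sum_le (fun j _ => hb.1 j) hb.2 (fun _ _ => Set.mem_univ _)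
  have hle : ∑ i : s, b i * G i (∑ j : s, b j • (j : E))
      ≤ ∑ i : s, ∑ j : s, b i * b j * G i j := by
    refine Finset.sum_le_sum fun i _ => ?_
    simpa only [Finset.mul_sum, mul_assoc] using
      mul_le_mul_of_nonneg_left (hjensen i) (hb.1 i)
  have hsymm : ∑ i : s, ∑ j : s, b i * b j * G i j = ∑ i : s, ∑ j : s, b i * b j * G j i := by
    rw [Finset.sum_comm]
    exact Finset.sum_congr rfl fun i _ => Finset.sum_congr rfl fun j _ => by
      rw [mul_comm (b j)]
  have hneg : ∑ i : s, ∑ j : s, b i * b j * G i j + ∑ i : s, ∑ j : s, b i * b j * G j i ≤ 0 := by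
    simp only [← Finset.sum_add_distrib, ← mul_add]
    exact Finset.sum_nonpos fun i _ => Finset.sum_nonpos fun j _ =>
      mul_nonpos_of_nonneg_of_nonpos (mul_nonneg (hb.1 i) (hb.1 j)) (hmono i j)
  linarith

theorem isClosed_toWeakSpace_image {Y : Type*} [NormedAddCommGroup Y] [NormedSpace ℝ Y]
    {C : Set Y} (hcl : IsClosed C) (hcv : Convex ℝ C) : IsClosed (toWeakSpace ℝ Y '' C) := by
  rw [← closure_eq_iff_isClosed, ← hcv.toWeakSpace_closure ℝ, hcl.closure_eq]

/-- In a reflexive space, bounded closed convex sets are weakly compact. -/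
theorem IsReflexive.isCompact_toWeakSpace_image {Y : Type*} [NormedAddCommGroup Y]
    [NormedSpace ℝ Y] (hY : IsReflexive Y) {C : Set Y} (hcl : IsClosed C) (hcv : Convex ℝ C)
    (hbd : IsBounded C) : IsCompact (toWeakSpace ℝ Y '' C) := by
  have hsurj : Function.Surjective (NormedSpace.inclusionInDoubleDualWeak ℝ Y) := fun z => by
    obtain ⟨y, hy⟩ := hY (WeakDual.toStrongDual z)
    exact ⟨toWeakSpace ℝ Y y, congrArg StrongDual.toWeakDual hy⟩
  rw [← (isClosed_toWeakSpace_image hcl hcv).closure_eq]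
  refine NormedSpace.isCompact_closure_of_isBounded ℝ Y _ ?_ ?_
  · rwa [Set.preimage_image_eq _ (toWeakSpace ℝ Y).injective]
  · rw [hsurj.range_eq]
    exact Set.subset_univ _

/-- Solvability of the Minty form of a monotone equilibrium problem on a closed convex set of a
reflexive space. -/
theorem IsReflexive.exists_forall_nonpos {Y : Type*} [NormedAddCommGroup Y] [NormedSpace ℝ Y]
    (hY : IsReflexive Y) {K : Set Y} (hKcl : IsClosed K) (hKcv : Convex ℝ K)
    {G : Y → Y → ℝ} (hcv : ∀ v, ConvexOn ℝ Set.univ (G v))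
    (hlsc : ∀ v, LowerSemicontinuous (G v)) (hmono : ∀ x y, G x y + G y x ≤ 0)
    {v₀ : Y} (hv₀ : v₀ ∈ K) (hbd : IsBounded {u | G v₀ u ≤ 0}) :
    ∃ u ∈ K, ∀ v ∈ K, G v u ≤ 0 := by
  classical
  have hCcl : ∀ v, IsClosed {u | u ∈ K ∧ G v u ≤ 0} := fun v =>
    hKcl.inter ((hlsc v).isClosed_preimage 0)
  have hCcv : ∀ v, Convex ℝ {u | u ∈ K ∧ G v u ≤ 0} := fun v => by
    have h := (hcv v).convex_le 0
    simp only [Set.mem_univ, true_and] at h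
    exact hKcv.inter h
  obtain ⟨z, ⟨u, ⟨huK, -⟩, rfl⟩, hz⟩ :=
    (hY.isCompact_toWeakSpace_image (hCcl v₀) (hCcv v₀)
      (hbd.subset fun u hu => hu.2)).inter_iInter_nonempty
      (fun v : K => toWeakSpace ℝ Y '' {u | u ∈ K ∧ G v u ≤ 0})
      (fun v => isClosed_toWeakSpace_image (hCcl v) (hCcv v)) (fun t => by
        obtain ⟨u, hu, hut⟩ := exists_mem_convexHull_forall_nonpos hcv hlsc hmono
          (s := insert v₀ (t.image Subtype.val)) (Finset.insert_nonempty _ _)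
        have huK : u ∈ K := by
          refine convexHull_min ?_ hKcv hu
          intro x hx
          simp only [Finset.coe_insert, Finset.coe_image, Set.mem_insert_iff, Set.mem_image] at hx
          rcases hx with rfl | ⟨y, -, rfl⟩
          exacts [hv₀, y.2]
        refine ⟨toWeakSpace ℝ Y u, ⟨u, ⟨huK, hut _ (Finset.mem_insert_self _ _)⟩, rfl⟩, ?_⟩
        refine Set.mem_iInter₂.2 fun v hv => ⟨u, ⟨huK, hut _ ?_⟩, rfl⟩
        exact Finset.mem_insert_of_mem (Finset.mem_image_of_mem _ hv))
  refine ⟨u, huK, fun v hv => ?_⟩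
  obtain ⟨u', ⟨-, hu'⟩, h⟩ := Set.mem_iInter.1 hz ⟨v, hv⟩
  rwa [(toWeakSpace ℝ Y).injective h] at hu'

/-- Adding a multiple of `‖· - v‖ ^ 2` to a convex lower semicontinuous function makes it
coercive. -/
theorem ConvexOn.isBounded_setOf_add_sq_norm_sub_nonpos {Y : Type*} [NormedAddCommGroup Y]
    [NormedSpace ℝ Y] {H : Y → ℝ} (hcv : ConvexOn ℝ Set.univ H) (hlsc : LowerSemicontinuous H)
    {v : Y} (hv : H v = 0) {c : ℝ} (hc : 0 < c) :
    IsBounded {u | H u + c * ‖u - v‖ ^ 2 ≤ 0} := by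
  obtain ⟨r, hr, hball⟩ := Metric.eventually_nhds_iff.1 (hlsc v (-1) (by simp [hv]))
  refine (Metric.isBounded_closedBall (x := v) (r := max r (2 / (c * r)))).subset fun u hu => ?_
  rw [Metric.mem_closedBall, dist_eq_norm, le_max_iff]
  by_contra! hcon
  obtain ⟨h1, h2⟩ := hcon
  have hu' : H u + c * ‖u - v‖ ^ 2 ≤ 0 := hu
  have hpos : 0 < ‖u - v‖ := hr.trans h1
  set t : ℝ := r / (2 * ‖u - v‖) with ht
  have ht0 : 0 < t := by positivity
  have htn : t * ‖u - v‖ = r / 2 := by rw [ht]; field_simp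
  have ht1 : t ≤ 1 := by
    by_contra! h
    nlinarith
  have hp := hball (y := (1 - t) • v + t • u) (by
    rw [dist_eq_norm, show (1 - t) • v + t • u - v = t • (u - v) by module, norm_smul,
      Real.norm_of_nonneg ht0.le, htn]
    linarith)
  have hconv := hcv.2 (Set.mem_univ v) (Set.mem_univ u) (sub_nonneg.2 ht1) ht0.le (by ring)
  simp only [smul_eq_mul, hv, mul_zero, zero_add] at hconv
  have h3 : 2 < ‖u - v‖ * (c * r) := (div_lt_iff₀ (by positivity)).1 h2
  have h4 : t * (c * ‖u - v‖ ^ 2) = ‖u - v‖ * (c * r) / 2 := by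
    rw [show t * (c * ‖u - v‖ ^ 2) = (t * ‖u - v‖) * (c * ‖u - v‖) by ring, htn]; ring
  nlinarith [mul_le_mul_of_nonneg_left hu' ht0.le]

/-- Along strongly convergent sequences, upper bounds on `⟨A uₙ, uₙ - v⟩` pass to the limit. -/
theorem Pseudomonotone.apply_sub_le_of_tendsto {Y : Type*} [NormedAddCommGroup Y]
    [NormedSpace ℝ Y] {A : Y → Y →L[ℝ] ℝ} (hA : Pseudomonotone A) {u : ℕ → Y} {w v : Y}
    (hu : Tendsto u atTop (𝓝 w)) {c : ℕ → ℝ} {l : ℝ} (hc : Tendsto c atTop (𝓝 l))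
    (hle : ∀ n, A (u n) (u n - v) ≤ c n) : A w (w - v) ≤ l := by
  obtain ⟨M, hM⟩ := (hA.1 _ (Metric.isBounded_range_of_tendsto u hu)).exists_norm_le
  have hAu : ∀ n x, |A (u n) x| ≤ M * ‖x‖ := fun n x =>
    (A (u n)).le_of_opNorm_le (hM _ ⟨u n, ⟨n, rfl⟩, rfl⟩) x
  have hzero : Tendsto (fun n => A (u n) (u n - w)) atTop (𝓝 0) := by
    refine squeeze_zero_norm (fun n => hAu n _) ?_
    simpa using (tendsto_iff_norm_sub_tendsto_zero.1 hu).const_mul M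
  have hbdd : IsBoundedUnder (· ≥ ·) atTop fun n => A (u n) (u n - v) := by
    have h := ((hu.sub_const v).norm.const_mul M).neg.isBoundedUnder_ge
    exact h.mono_ge (Eventually.of_forall fun n => (abs_le.1 (hAu n _)).1)
  calc A w (w - v) ≤ liminf (fun n => A (u n) (u n - v)) atTop :=
        hA.2 u w (fun g => (g.continuous.tendsto w).comp hu) hzero.limsup_eq.le v
    _ ≤ liminf c atTop := liminf_le_liminf (Eventually.of_forall hle) hbdd
        hc.isBoundedUnder_le.isCoboundedUnder_ge
    _ = l := hc.liminf_eq

/-- under (A1), (A2), (A4), (A5), (A7)'' and (A8), the constrained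
variational inequality has a unique solution `u ∈ K`. -/
theorem vi_exists_unique
    {X Xφ : Type*}
    [NormedAddCommGroup X] [NormedSpace ℝ X] [CompleteSpace X]
    [NormedAddCommGroup Xφ] [NormedSpace ℝ Xφ] [CompleteSpace Xφ]
    -- (A1)
    (hrefl : IsReflexive X)
    (K : Set X) (hKne : K.Nonempty) (hKcl : IsClosed K) (hKcv : Convex ℝ K)
    -- (A2)
    (γφ : X →L[ℝ] Xφ) (cφ : ℝ) (hcφ : 0 < cφ) (hγφ : ∀ v : X, ‖γφ v‖ ≤ cφ * ‖v‖)
    -- (A4)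
    (A : X → X →L[ℝ] ℝ) (hA : Pseudomonotone A)
    (mA : ℝ) (hmA : 0 < mA)
    (hAsm : ∀ v₁ v₂ : X, mA * ‖v₁ - v₂‖ ^ 2 ≤ (A v₁ - A v₂) (v₁ - v₂))
    -- (A5)
    (φ : Xφ → Xφ → ℝ)
    (hφcv : ∀ z : Xφ, ConvexOn ℝ Set.univ (φ z))
    (hφlsc : ∀ z : Xφ, LowerSemicontinuous (φ z))
    (αφ : ℝ) (hαφ : 0 ≤ αφ)
    (hφ : ∀ z₁ z₂ z₃ z₄ : Xφ,
      φ z₁ z₄ - φ z₁ z₃ + φ z₂ z₃ - φ z₂ z₄ ≤ αφ * ‖z₁ - z₂‖ * ‖z₃ - z₄‖)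
    -- (A7)''
    (hsmall : αφ * cφ ^ 2 < mA)
    -- (A8)
    (f : X →L[ℝ] ℝ) :
    ∃! u : X, u ∈ K ∧ ∀ v ∈ K,
      f (v - u) ≤ A u (v - u) + (φ (γφ u) (γφ v) - φ (γφ u) (γφ u)) := by
  set F : X → X → ℝ := fun u v =>
    A u (v - u) - f (v - u) + (φ (γφ u) (γφ v) - φ (γφ u) (γφ u)) with hF
  have hFself : ∀ u, F u u = 0 := fun u => by simp [hF]
  have hFcv : ∀ u, ConvexOn ℝ Set.univ (F u) := fun u => by
    refine ⟨convex_univ, fun x _ y _ p q hp hq hpq => ?_⟩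
    have h := (hφcv (γφ u)).2 (Set.mem_univ (γφ x)) (Set.mem_univ (γφ y)) hp hq hpq
    obtain rfl : q = 1 - p := by linarith
    simp only [hF, map_sub, map_add, map_smul, smul_eq_mul] at h ⊢
    linarith
  have hφγ : ∀ z, LowerSemicontinuous fun v => φ z (γφ v) := fun z =>
    (hφlsc z).comp γφ.continuous
  have hFlsc : ∀ u, LowerSemicontinuous (F u) := fun u =>
    (by fun_prop : Continuous fun v => A u (v - u) - f (v - u)).lowerSemicontinuous.add
      (by simpa only [sub_eq_add_neg] using (hφγ _).add lowerSemicontinuous_const)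
  set δ : ℝ := mA - αφ * cφ ^ 2 with hδ
  have hδ0 : 0 < δ := sub_pos.2 hsmall
  have hFmono : ∀ u v, F u v + F v u ≤ -(δ * ‖u - v‖ ^ 2) := fun u v => by
    have h1 := hAsm u v
    have h2 := hφ (γφ u) (γφ v) (γφ u) (γφ v)
    have h3 : ‖γφ u - γφ v‖ ≤ cφ * ‖u - v‖ := by rw [← map_sub]; exact hγφ _
    have h4 : αφ * ‖γφ u - γφ v‖ * ‖γφ u - γφ v‖ ≤ αφ * cφ ^ 2 * ‖u - v‖ ^ 2 := by
      have := mul_le_mul_of_nonneg_left (pow_le_pow_left₀ (norm_nonneg _) h3 2) hαφ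
      nlinarith
    simp only [hF, hδ, map_sub, sub_apply] at h1 ⊢
    linarith
  -- The Minty form `F v u ≤ 0` is equivalent to the Stampacchia form `0 ≤ F u v`.
  obtain ⟨v₀, hv₀⟩ := hKne
  obtain ⟨u, huK, hu⟩ := hrefl.exists_forall_nonpos hKcl hKcv
    (G := fun v u => F v u + δ / 2 * ‖u - v‖ ^ 2)
    (fun v => (hFcv v).add <| by
      have := ((convexOn_univ_dist v).pow (fun _ _ => dist_nonneg) 2).smul (half_pos hδ0).le
      simpa [dist_eq_norm] using this)
    (fun v => (hFlsc v).add (by fun_prop :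
      Continuous fun u => δ / 2 * ‖u - v‖ ^ 2).lowerSemicontinuous)
    (fun x y => by
      have := hFmono x y
      rw [norm_sub_rev y x]
      linarith)
    hv₀ ((hFcv v₀).isBounded_setOf_add_sq_norm_sub_nonpos (hFlsc v₀) (hFself v₀) (half_pos hδ0))
  have hminty : ∀ v ∈ K, F v u ≤ 0 := fun v hv => by
    have := hu v hv
    have : 0 ≤ δ / 2 * ‖u - v‖ ^ 2 := by positivity
    linarith
  have hsol : ∀ v ∈ K, 0 ≤ F u v := fun v hv => by
    set t : ℕ → ℝ := fun n => 1 / ((n : ℝ) + 1) with ht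
    have ht0 : ∀ n, 0 < t n := fun n => Nat.one_div_pos_of_nat
    have ht1 : ∀ n, t n ≤ 1 := fun n => by
      rw [ht]; exact div_le_one_of_le₀ (by simp) (by positivity)
    set x : ℕ → X := fun n => (1 - t n) • u + t n • v with hx
    have hxu : Tendsto x atTop (𝓝 u) := by
      have h : Tendsto t atTop (𝓝 0) := tendsto_one_div_add_atTop_nhds_zero_nat
      simpa using ((h.const_sub 1).smul_const u).add (h.smul_const v)
    have hFx : ∀ n, 0 ≤ F (x n) v := fun n => by
      have hxK : x n ∈ K := hKcv huK hv (sub_nonneg.2 (ht1 n)) (ht0 n).le (by ring)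
      have h := (hFcv (x n)).2 (Set.mem_univ u) (Set.mem_univ v)
        (sub_nonneg.2 (ht1 n)) (ht0 n).le (by ring)
      change F (x n) (x n) ≤ _ at h
      rw [hFself, smul_eq_mul, smul_eq_mul] at h
      have h' := mul_nonpos_of_nonneg_of_nonpos (sub_nonneg.2 (ht1 n)) (hminty _ hxK)
      exact nonneg_of_mul_nonneg_right (by linarith) (ht0 n)
    refine le_of_forall_pos_le_add fun ε hε => ?_
    obtain ⟨N, hN⟩ := eventually_atTop.1 (hxu.eventually
      (hφγ (γφ u) u (φ (γφ u) (γφ u) - ε) (by linarith)))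
    have hlim : Tendsto (fun n => -f (v - x n) + (φ (γφ u) (γφ v) - φ (γφ u) (γφ u) + ε)
        + αφ * ‖γφ (x n) - γφ u‖ * ‖γφ (x n) - γφ v‖) atTop
        (𝓝 (-f (v - u) + (φ (γφ u) (γφ v) - φ (γφ u) (γφ u) + ε)
        + αφ * ‖γφ u - γφ u‖ * ‖γφ u - γφ v‖)) :=
      ((by fun_prop : Continuous fun y => -f (v - y) + (φ (γφ u) (γφ v) - φ (γφ u) (γφ u) + ε)
        + αφ * ‖γφ y - γφ u‖ * ‖γφ y - γφ v‖).tendsto u).comp hxu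
    have hle := hA.apply_sub_le_of_tendsto (v := v)
      (hxu.comp (tendsto_add_atTop_nat N)) (hlim.comp (tendsto_add_atTop_nat N)) fun n => by
        have h1 := hFx (n + N)
        have h2 := hN (n + N) (Nat.le_add_left N n)
        have h3 := hφ (γφ (x (n + N))) (γφ u) (γφ (x (n + N))) (γφ v)
        simp only [hF, map_sub, Function.comp_apply] at h1 h2 h3 ⊢
        linarith
    simp only [hF, map_sub, sub_self, norm_zero, mul_zero, zero_mul] at hle ⊢
    linarith
  refine ⟨u, ⟨huK, fun v hv => ?_⟩, fun w hw => ?_⟩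
  · have := hsol v hv
    simp only [hF] at this
    linarith
  · have h1 := hsol w hw.1
    have h2 : 0 ≤ F w u := by
      have := hw.2 u huK
      simp only [hF]
      linarith
    have h3 := hFmono w u
    have h4 : ‖w - u‖ ^ 2 ≤ 0 := by
      by_contra! h
      nlinarith [mul_pos hδ0 h]
    exact sub_eq_zero.1 (norm_eq_zero.1 (pow_eq_zero_iff two_ne_zero |>.1
      (le_antisymm h4 (sq_nonneg _))))
end

section
/- Assume (A1), (A2), (A4), (A5), (A7)'' (α_φ c_φ² < m_A), (A8), and (A10)'' (γ_φ is a compact operator), let P : X → X* be a penalty operator for K, and let u ∈ K be the unique solution of the constrained variational inequality: ⟨A u, v − u⟩ + φ(γ_φ u, γ_φ v) − φ(γ_φ u, γ_φ u) ≥ ⟨f, v − u⟩ for all v ∈ K. Let (εₙ) be a sequence of positive numbers with εₙ → 0, and let (Vₙ) be a sequence of finite-dimensional linear subspaces of X satisfying (A9): for every v ∈ X there exist vₙ ∈ Vₙ with vₙ → v strongly in X, and for every v ∈ K there exist vₙ ∈ Vₙ ∩ K with vₙ → v strongly in X. For each n, let uₙ ∈ Vₙ satisfy ⟨A uₙ,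 vʰ − uₙ⟩ + (1/εₙ) ⟨P uₙ, vʰ − uₙ⟩ + φ(γ_φ uₙ, γ_φ vʰ) − φ(γ_φ uₙ, γ_φ uₙ) ≥ ⟨f, vʰ − uₙ⟩ for all vʰ ∈ Vₙ. Then uₙ → u strongly in X as n → ∞. -/
open Filter Topology Bornology

/-- A finite convex lower semicontinuous function on a Banach space is continuous. -/
lemma ConvexOn.continuous_of_lowerSemicontinuous {E : Type*} [NormedAddCommGroup E]
    [NormedSpace ℝ E] [CompleteSpace E] {g : E → ℝ} (hcv : ConvexOn ℝ Set.univ g)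
    (hlsc : LowerSemicontinuous g) : Continuous g := by
  have hcover : ⋃ n : ℕ, g ⁻¹' Set.Iic (n : ℝ) = Set.univ := by
    refine Set.eq_univ_of_forall fun x => ?_
    obtain ⟨n, hn⟩ := exists_nat_ge (g x)
    exact Set.mem_iUnion.2 ⟨n, hn⟩
  obtain ⟨n, x, hx⟩ := nonempty_interior_of_iUnion_of_closed
    (fun n : ℕ => hlsc.isClosed_preimage (n : ℝ)) hcover
  have hbdd : (𝓝 x).IsBoundedUnder (· ≤ ·) g :=
    isBoundedUnder_of_eventually_le (a := (n : ℝ)) (mem_interior_iff_mem_nhds.1 hx)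
  rw [← continuousOn_univ]
  refine ((hcv.continuousOn_tfae isOpen_univ Set.univ_nonempty).out 3 1).mp ?_
  exact ⟨x, Set.mem_univ x, hbdd⟩

lemma ConvexOn.exists_norm_lower_bound {E : Type*} [NormedAddCommGroup E]
    [NormedSpace ℝ E] {g : E → ℝ} (hcv : ConvexOn ℝ Set.univ g)
    (hlsc : LowerSemicontinuous g) : ∃ C, 0 ≤ C ∧ ∀ x, -(C * (1 + ‖x‖)) ≤ g x := by
  obtain ⟨l, c, hle, -⟩ := hcv.exists_affine_le_of_lt (𝕜 := ℝ) (x := 0) (a := g 0 - 1)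
    (Set.mem_univ _) (by simp) isClosed_univ (hlsc.lowerSemicontinuousOn _)
  refine ⟨‖l‖ + |c|, by positivity, fun x => ?_⟩
  have h1 : l x + c ≤ g x := by simpa using hle ⟨x, Set.mem_univ x⟩
  have h2 : -(‖l‖ * ‖x‖) ≤ l x := (abs_le.1 (l.le_opNorm x)).1
  nlinarith [neg_abs_le c, norm_nonneg l, mul_nonneg (abs_nonneg c) (norm_nonneg x)]

/-- In a reflexive space, a bounded family converges weakly along every ultrafilter. -/
lemma IsReflexive.exists_weak_limit {Y ι : Type*} [NormedAddCommGroup Y] [NormedSpace ℝ Y]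
    (hY : IsReflexive Y) {x : ι → Y} {C : ℝ} (hx : ∀ i, ‖x i‖ ≤ C) (U : Ultrafilter ι) :
    ∃ w, ∀ g : Y →L[ℝ] ℝ, Tendsto (fun i => g (x i)) U (𝓝 (g w)) := by
  let J : ι → WeakDual ℝ (StrongDual ℝ Y) := fun i =>
    StrongDual.toWeakDual (NormedSpace.inclusionInDoubleDual ℝ Y (x i))
  have hmem : (U.map J : Filter _) ≤
      𝓟 (WeakDual.toStrongDual ⁻¹' Metric.closedBall (0 : StrongDual ℝ (StrongDual ℝ Y)) C) := by
    rw [le_principal_iff]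
    refine Filter.mem_map.2 (Filter.univ_mem' fun i => ?_)
    have : ‖NormedSpace.inclusionInDoubleDual ℝ Y (x i)‖ ≤ C :=
      (NormedSpace.double_dual_bound ℝ Y (x i)).trans (hx i)
    exact (mem_closedBall_zero_iff (E := StrongDual ℝ (StrongDual ℝ Y))).2 this
  obtain ⟨F, -, hF⟩ := (WeakDual.isCompact_closedBall
    (0 : StrongDual ℝ (StrongDual ℝ Y)) C).ultrafilter_le_nhds _ hmem
  obtain ⟨w, hw⟩ := hY (WeakDual.toStrongDual F)
  refine ⟨w, fun g => ?_⟩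
  have h := ((WeakDual.eval_continuous (𝕜 := ℝ) g).tendsto F).comp
    (show Tendsto J U (𝓝 F) from hF)
  have hFg : F g = g w := by
    rw [← NormedSpace.dual_def ℝ Y w g, hw]
    rfl
  rw [hFg] at h
  exact h

/-- A compact operator turns weak convergence of a bounded family along an ultrafilter into
strong convergence. -/
lemma IsCompactOperator.tendsto_of_weak {Y Z ι : Type*} [NormedAddCommGroup Y]
    [NormedSpace ℝ Y] [NormedAddCommGroup Z] [NormedSpace ℝ Z] {T : Y →L[ℝ] Z}
    (hT : IsCompactOperator T) {x : ι → Y} {C : ℝ} (hx : ∀ i, ‖x i‖ ≤ C) {U : Ultrafilter ι}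
    {w : Y} (hw : ∀ g : Y →L[ℝ] ℝ, Tendsto (fun i => g (x i)) U (𝓝 (g w))) :
    Tendsto (fun i => T (x i)) U (𝓝 (T w)) := by
  obtain ⟨S, hS, hsub⟩ := IsCompactOperator.image_subset_compact_of_bounded
    (f := (T : Y →ₗ[ℝ] Z)) hT (Metric.isBounded_closedBall (x := (0 : Y)) (r := C))
  have hmem : (U.map (fun i => T (x i)) : Filter Z) ≤ 𝓟 S := by
    rw [le_principal_iff]
    exact Filter.mem_map.2 (Filter.univ_mem' fun i =>
      hsub ⟨x i, by simpa using hx i, rfl⟩)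
  obtain ⟨y, -, hy⟩ := hS.ultrafilter_le_nhds _ hmem
  have hy' : Tendsto (fun i => T (x i)) U (𝓝 y) := hy
  suffices y = T w by rwa [this] at hy'
  rw [SeparatingDual.eq_iff_forall_dual_eq (R := ℝ)]
  exact fun g => tendsto_nhds_unique ((g.continuous.tendsto y).comp hy') (hw (g.comp T))

/-- Minty's argument: a demicontinuous operator satisfying the Minty inequality with zero
right-hand side at `w` vanishes at `w`. -/
lemma eq_zero_of_minty {Y : Type*} [NormedAddCommGroup Y] [NormedSpace ℝ Y]
    {P : Y → Y →L[ℝ] ℝ}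
    (hP : ∀ (u : ℕ → Y) (w : Y), Tendsto u atTop (𝓝 w) →
      ∀ v : Y, Tendsto (fun n => P (u n) v) atTop (𝓝 (P w v)))
    {w : Y} (hw : ∀ v, P v (w - v) ≤ 0) : P w = 0 := by
  have hnonneg : ∀ z, 0 ≤ P w z := by
    intro z
    have ht : Tendsto (fun n : ℕ => w + (1 / ((n : ℝ) + 1)) • z) atTop (𝓝 w) := by
      simpa using tendsto_const_nhds.add
        ((tendsto_one_div_add_atTop_nhds_zero_nat (𝕜 := ℝ)).smul_const z)
    refine ge_of_tendsto' (hP _ _ ht z) fun n => ?_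
    have hpos : (0 : ℝ) < 1 / ((n : ℝ) + 1) := by positivity
    have h := hw (w + (1 / ((n : ℝ) + 1)) • z)
    rw [sub_add_cancel_left, map_neg, map_smul, smul_eq_mul] at h
    by_contra! hneg
    nlinarith [mul_neg_of_pos_of_neg hpos hneg]
  ext z
  have h1 := hnonneg z
  have h2 := hnonneg (-z)
  rw [map_neg] at h2
  simpa using le_antisymm (by linarith) h1

lemma Filter.Tendsto.exists_norm_le {Y : Type*} [NormedAddCommGroup Y] {x : ℕ → Y} {y : Y}
    (h : Tendsto x atTop (𝓝 y)) : ∃ C, 0 ≤ C ∧ ∀ n, ‖x n‖ ≤ C := by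
  obtain ⟨C, hC⟩ := (Metric.isBounded_range_of_tendsto x h).exists_norm_le
  exact ⟨C, (norm_nonneg _).trans (hC (x 0) ⟨0, rfl⟩), fun n => hC _ ⟨n, rfl⟩⟩

lemma BoundedOperator.exists_norm_le {Y : Type*} [NormedAddCommGroup Y] [NormedSpace ℝ Y]
    {A : Y → Y →L[ℝ] ℝ} (hA : BoundedOperator A) {x : ℕ → Y} {C : ℝ} (hx : ∀ n, ‖x n‖ ≤ C) :
    ∃ D, 0 ≤ D ∧ ∀ n, ‖A (x n)‖ ≤ D := by
  obtain ⟨D, hD⟩ := (hA _ (Metric.isBounded_closedBall (x := (0 : Y)) (r := C))).exists_norm_le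
  have h : ∀ n, ‖A (x n)‖ ≤ D := fun n => hD _ ⟨x n, by simpa using hx n, rfl⟩
  exact ⟨D, (norm_nonneg _).trans (h 0), h⟩

lemma tendsto_apply_zero_of_norm_le {Y ι : Type*} [NormedAddCommGroup Y] [NormedSpace ℝ Y]
    {l : Filter ι} {L : ι → Y →L[ℝ] ℝ} {x : ι → Y} {D : ℝ} (hL : ∀ n, ‖L n‖ ≤ D)
    (hx : Tendsto x l (𝓝 0)) : Tendsto (fun n => L n (x n)) l (𝓝 0) := by
  refine squeeze_zero_norm (a := fun n => D * ‖x n‖) (fun n => ?_) ?_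
  · exact ((L n).le_opNorm _).trans (mul_le_mul_of_nonneg_right (hL n) (norm_nonneg _))
  · simpa using hx.norm.const_mul D

lemma le_of_mul_sq_le_add_mul {m a b x : ℝ} (hm : 0 < m) (ha : 0 ≤ a) (hb : 0 ≤ b)
    (h : m * x ^ 2 ≤ a + b * x) : x ≤ 1 + (a + b) / m := by
  by_contra! hx
  have hq : 0 ≤ (a + b) / m := by positivity
  have hmx : m + (a + b) < m * x := by
    have := mul_lt_mul_of_pos_left hx hm
    rwa [mul_add, mul_one, mul_div_cancel₀ _ hm.ne'] at this
  nlinarith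


/-- Corollary: convergence of the penalty based numerical method for the
constrained variational inequality: under (A1), (A2), (A4), (A5), (A7)'', (A8),
(A9), (A10)'', the discrete penalized solutions converge strongly to `u`. -/
theorem vi_penalized_numerical_convergence
    {X Xφ : Type*}
    [NormedAddCommGroup X] [NormedSpace ℝ X] [CompleteSpace X]
    [NormedAddCommGroup Xφ] [NormedSpace ℝ Xφ] [CompleteSpace Xφ]
    -- (A1)
    (hrefl : IsReflexive X)
    (K : Set X) (hKne : K.Nonempty) (hKcl : IsClosed K) (hKcv : Convex ℝ K)
    -- (A2)
    (γφ : X →L[ℝ] Xφ) (cφ : ℝ) (hcφ : 0 < cφ) (hγφ : ∀ v : X, ‖γφ v‖ ≤ cφ * ‖v‖)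
    -- (A4)
    (A : X → X →L[ℝ] ℝ) (hA : Pseudomonotone A)
    (mA : ℝ) (hmA : 0 < mA)
    (hAsm : ∀ v₁ v₂ : X, mA * ‖v₁ - v₂‖ ^ 2 ≤ (A v₁ - A v₂) (v₁ - v₂))
    -- (A5)
    (φ : Xφ → Xφ → ℝ)
    (hφcv : ∀ z : Xφ, ConvexOn ℝ Set.univ (φ z))
    (hφlsc : ∀ z : Xφ, LowerSemicontinuous (φ z))
    (αφ : ℝ) (hαφ : 0 ≤ αφ)
    (hφ : ∀ z₁ z₂ z₃ z₄ : Xφ,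
      φ z₁ z₄ - φ z₁ z₃ + φ z₂ z₃ - φ z₂ z₄ ≤ αφ * ‖z₁ - z₂‖ * ‖z₃ - z₄‖)
    -- (A7)''
    (hsmall : αφ * cφ ^ 2 < mA)
    -- (A8)
    (f : X →L[ℝ] ℝ)
    -- (A10)''
    (hγφcpt : IsCompactOperator γφ)
    -- penalty operator
    (P : X → X →L[ℝ] ℝ) (hP : IsPenaltyOperator P K)
    -- the solution of the constrained variational inequality
    (u : X) (huK : u ∈ K)
    (hu : ∀ v ∈ K,
      f (v - u) ≤ A u (v - u) + (φ (γφ u) (γφ v) - φ (γφ u) (γφ u)))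
    -- penalty parameters
    (ε : ℕ → ℝ) (hε : ∀ n, 0 < ε n) (hε0 : Tendsto ε atTop (𝓝 0))
    -- (A9)
    (V : ℕ → Submodule ℝ X) (hV : ∀ n, FiniteDimensional ℝ (V n))
    (hA9X : ∀ v : X, ∃ vh : ℕ → X, (∀ n, vh n ∈ V n) ∧ Tendsto vh atTop (𝓝 v))
    (hA9K : ∀ v ∈ K, ∃ vh : ℕ → X, (∀ n, vh n ∈ V n ∧ vh n ∈ K) ∧ Tendsto vh atTop (𝓝 v))
    -- the discrete penalized solutions
    (un : ℕ → X) (hunV : ∀ n, un n ∈ V n)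
    (hun : ∀ n, ∀ vh ∈ V n,
      f (vh - un n) ≤ A (un n) (vh - un n) + (1 / ε n) * P (un n) (vh - un n)
        + (φ (γφ (un n)) (γφ vh) - φ (γφ (un n)) (γφ (un n)))) :
    Tendsto un atTop (𝓝 u) := by
  obtain ⟨hPbdd, hPdemi, hPmono, hPker⟩ := hP
  have hPK : ∀ v ∈ K, P v = 0 := fun v hv => by rwa [← hPker] at hv
  set ψ : X → ℝ := fun v => φ (γφ u) (γφ v) with hψdef
  have hψ : Continuous ψ :=
    ((hφcv (γφ u)).continuous_of_lowerSemicontinuous (hφlsc _)).comp γφ.continuous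
  have hφψ : ∀ x v, φ (γφ x) (γφ v) - φ (γφ x) (γφ x)
      ≤ ψ v - ψ x + αφ * ‖γφ x - γφ u‖ * ‖γφ x - γφ v‖ := fun x v => by
    have := hφ (γφ x) (γφ u) (γφ x) (γφ v)
    simp only [hψdef]
    linarith
  have hγsub : ∀ x y, ‖γφ x - γφ y‖ ≤ cφ * ‖x - y‖ := fun x y => by
    rw [← map_sub]
    exact hγφ _
  have hest : ∀ n, ∀ v ∈ V n, A (un n) (un n - v) + (1 / ε n) * P (un n) (un n - v)
      ≤ f (un n - v) + ψ v - ψ (un n)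
        + αφ * ‖γφ (un n) - γφ u‖ * ‖γφ (un n) - γφ v‖ := by
    intro n v hv
    have h1 := hun n v hv
    have h2 := hφψ (un n) v
    rw [← neg_sub (un n) v, map_neg, map_neg, map_neg] at h1
    linarith
  obtain ⟨vh, hvh, hvhu⟩ := hA9K u huK
  have hestK : ∀ n, A (un n) (un n - vh n) ≤ f (un n - vh n) + ψ (vh n) - ψ (un n)
        + αφ * ‖γφ (un n) - γφ u‖ * ‖γφ (un n) - γφ (vh n)‖ := by
    intro n
    have h1 := hest n (vh n) (hvh n).1
    have h2 := hPmono (un n) (vh n)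
    rw [hPK _ (hvh n).2, sub_zero] at h2
    have h3 := mul_nonneg (one_div_pos.2 (hε n)).le h2
    linarith
  obtain ⟨Cψ, hCψ0, hCψ⟩ : ∃ C, 0 ≤ C ∧ ∀ x, -(C * (1 + ‖x‖)) ≤ ψ x := by
    obtain ⟨C, hC, h⟩ := (hφcv (γφ u)).exists_norm_lower_bound (hφlsc _)
    refine ⟨C * (1 + cφ), by positivity, fun x => le_trans ?_ (h (γφ x))⟩
    have := mul_le_mul_of_nonneg_left (hγφ x) hC
    nlinarith [mul_nonneg hC hcφ.le, mul_nonneg hC (norm_nonneg x)]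
  obtain ⟨C, hC⟩ : ∃ C, ∀ n, ‖un n‖ ≤ C := by
    obtain ⟨Cv, hCv0, hCv⟩ := hvhu.exists_norm_le
    obtain ⟨Dv, hDv0, hDv⟩ := hA.1.exists_norm_le hCv
    obtain ⟨Cp, hCp0, hCp⟩ := ((hψ.tendsto u).comp hvhu).exists_norm_le
    obtain ⟨Cd, hCd0, hCd⟩ := (hvhu.sub_const u).exists_norm_le
    refine ⟨1 + ((Cp + Cψ * (1 + Cv)) + (‖f‖ + Dv + Cψ + αφ * cφ ^ 2 * Cd))
      / (mA - αφ * cφ ^ 2) + Cv, fun n => ?_⟩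
    set x := ‖un n - vh n‖ with hx
    have hx0 : 0 ≤ x := norm_nonneg _
    have hunle : ‖un n‖ ≤ x + Cv := by
      have := norm_le_norm_sub_add (un n) (vh n)
      linarith [hCv n]
    have h1 := hAsm (un n) (vh n)
    rw [sub_apply, ← hx] at h1
    have h2 := hestK n
    have h3 : f (un n - vh n) ≤ ‖f‖ * x := (le_abs_self _).trans (f.le_opNorm _)
    have h4 : -(A (vh n) (un n - vh n)) ≤ Dv * x := (neg_le_abs _).trans
      (((A (vh n)).le_opNorm _).trans (mul_le_mul_of_nonneg_right (hDv n) hx0))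
    have h5 : ψ (vh n) ≤ Cp := (le_abs_self _).trans (hCp n)
    have h6 : -ψ (un n) ≤ Cψ * (1 + Cv) + Cψ * x := by
      have := mul_le_mul_of_nonneg_left hunle hCψ0
      linarith [hCψ (un n)]
    have h7 : αφ * ‖γφ (un n) - γφ u‖ * ‖γφ (un n) - γφ (vh n)‖
        ≤ αφ * (cφ * (x + Cd)) * (cφ * x) := by
      have ha : ‖un n - u‖ ≤ x + Cd :=
        (norm_sub_le_norm_sub_add_norm_sub _ (vh n) _).trans (add_le_add le_rfl (hCd n))
      have hb := (hγsub (un n) u).trans (mul_le_mul_of_nonneg_left ha hcφ.le)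
      gcongr
      exact hγsub _ _
    have h8 := le_of_mul_sq_le_add_mul (m := mA - αφ * cφ ^ 2) (x := x)
      (a := Cp + Cψ * (1 + Cv)) (b := ‖f‖ + Dv + Cψ + αφ * cφ ^ 2 * Cd)
      (by linarith) (by positivity) (by positivity) (by nlinarith)
    linarith
  obtain ⟨DA, hDA0, hDA⟩ := hA.1.exists_norm_le hC
  obtain ⟨DP, -, hDP⟩ := hPbdd.exists_norm_le hC
  have hC0 : 0 ≤ C := (norm_nonneg _).trans (hC 0)
  rw [tendsto_iff_ultrafilter]
  intro U hU
  obtain ⟨w, hw⟩ := hrefl.exists_weak_limit hC U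
  have hγw := hγφcpt.tendsto_of_weak hC hw
  have hwK : w ∈ K := by
    rw [← hPker]
    refine eq_zero_of_minty hPdemi fun v => ?_
    obtain ⟨vn, hvn, hvnv⟩ := hA9X v
    obtain ⟨B, hB⟩ : ∃ B, ∀ n, (1 / ε n) * P (un n) (un n - vn n) ≤ B := by
      obtain ⟨Cv, hCv0, hCv⟩ := hvnv.exists_norm_le
      obtain ⟨Cp, -, hCp⟩ := ((hψ.tendsto v).comp hvnv).exists_norm_le
      refine ⟨(‖f‖ + DA) * (C + Cv) + Cp + Cψ * (1 + C)
        + αφ * (cφ * (C + ‖u‖)) * (cφ * (C + Cv)), fun n => ?_⟩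
      have h0 : ‖un n - vn n‖ ≤ C + Cv := (norm_sub_le _ _).trans (add_le_add (hC n) (hCv n))
      have h0' : ‖un n - u‖ ≤ C + ‖u‖ := (norm_sub_le _ _).trans (add_le_add (hC n) le_rfl)
      have h1 := hest n (vn n) (hvn n)
      have h2 : f (un n - vn n) ≤ ‖f‖ * (C + Cv) := (le_abs_self _).trans
        ((f.le_opNorm _).trans (mul_le_mul_of_nonneg_left h0 (norm_nonneg _)))
      have h3 : -(A (un n) (un n - vn n)) ≤ DA * (C + Cv) := (neg_le_abs _).trans
        (((A (un n)).le_opNorm _).trans (mul_le_mul (hDA n) h0 (norm_nonneg _) hDA0))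
      have h4 : ψ (vn n) ≤ Cp := (le_abs_self _).trans (hCp n)
      have h5 : -ψ (un n) ≤ Cψ * (1 + C) := by
        have := mul_le_mul_of_nonneg_left (hC n) hCψ0
        linarith [hCψ (un n)]
      have h6 : αφ * ‖γφ (un n) - γφ u‖ * ‖γφ (un n) - γφ (vn n)‖
          ≤ αφ * (cφ * (C + ‖u‖)) * (cφ * (C + Cv)) := by
        have ha := (hγsub (un n) u).trans (mul_le_mul_of_nonneg_left h0' hcφ.le)
        have hb := (hγsub (un n) (vn n)).trans (mul_le_mul_of_nonneg_left h0 hcφ.le)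
        gcongr
      linarith
    have hle : ∀ n, P v (un n - v) ≤ ε n * B + P (un n) (vn n - v) := by
      intro n
      have h1 := hPmono (un n) v
      rw [sub_apply] at h1
      have h2 := mul_le_mul_of_nonneg_left (hB n) (hε n).le
      rw [← mul_assoc, mul_one_div_cancel (hε n).ne', one_mul] at h2
      have h3 : P (un n) (un n - v) = P (un n) (un n - vn n) + P (un n) (vn n - v) := by
        rw [← map_add, sub_add_sub_cancel]
      linarith
    have hlim : Tendsto (fun n => ε n * B + P (un n) (vn n - v)) U (𝓝 0) := by
      have h1 := (hε0.mono_left hU).mul_const B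
      have h2 := tendsto_apply_zero_of_norm_le hDP
        (tendsto_sub_nhds_zero_iff.2 (hvnv.mono_left hU))
      simpa using h1.add h2
    refine le_of_tendsto_of_tendsto' ?_ hlim hle
    simpa only [map_sub] using (hw (P v)).sub_const (P v v)
  have hvhU : Tendsto vh U (𝓝 u) := hvhu.mono_left hU
  have hψun : Tendsto (fun n => ψ (un n)) U (𝓝 (ψ w)) :=
    (((hφcv (γφ u)).continuous_of_lowerSemicontinuous (hφlsc _)).tendsto _).comp hγw
  have hψvh : Tendsto (fun n => ψ (vh n)) U (𝓝 (ψ u)) := (hψ.tendsto u).comp hvhU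
  have hγvh : Tendsto (fun n => γφ (vh n)) U (𝓝 (γφ u)) := (γφ.continuous.tendsto u).comp hvhU
  have hupper : ∀ n, (mA - αφ * cφ ^ 2) * ‖un n - u‖ ^ 2
      ≤ A (un n) (vh n - u) + (f (un n) - f (vh n)) - (A u (un n) - A u u)
        + (ψ (vh n) - ψ (un n)) + αφ * ‖γφ (un n) - γφ u‖ * ‖γφ (un n) - γφ (vh n)‖
        - αφ * ‖γφ (un n) - γφ u‖ ^ 2 := by
    intro n
    have h1 := hAsm (un n) u
    rw [sub_apply, map_sub (A u)] at h1
    have h2 := hestK n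
    rw [map_sub f] at h2
    have h3 : A (un n) (un n - u) = A (un n) (un n - vh n) + A (un n) (vh n - u) := by
      rw [← map_add, sub_add_sub_cancel]
    have h4 : αφ * ‖γφ (un n) - γφ u‖ ^ 2 ≤ αφ * (cφ * ‖un n - u‖) ^ 2 := by
      gcongr
      exact hγsub _ _
    linarith [mul_pow cφ ‖un n - u‖ 2]
  have hlim := ((((((tendsto_apply_zero_of_norm_le hDA (tendsto_sub_nhds_zero_iff.2 hvhU)).add
    ((hw f).sub ((f.continuous.tendsto u).comp hvhU))).sub ((hw (A u)).sub_const (A u u))).add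
    (hψvh.sub hψun)).add (((hγw.sub_const (γφ u)).norm.const_mul αφ).mul
      (hγw.sub hγvh).norm)).sub (((hγw.sub_const (γφ u)).norm.pow 2).const_mul αφ))
  have hlim_le : 0 + (f w - f u) - (A u w - A u u) + (ψ u - ψ w)
      + αφ * ‖γφ w - γφ u‖ * ‖γφ w - γφ u‖ - αφ * ‖γφ w - γφ u‖ ^ 2 ≤ 0 := by
    have h := hu w hwK
    rw [map_sub, map_sub] at h
    simp only [hψdef]
    linarith
  have hpos : 0 < mA - αφ * cφ ^ 2 := by linarith
  have hsq : Tendsto (fun n => (mA - αφ * cφ ^ 2) * ‖un n - u‖ ^ 2) U (𝓝 0) := by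
    refine tendsto_order.2 ⟨fun a ha => Filter.Eventually.of_forall fun n =>
      ha.trans_le (by positivity), fun a ha => ?_⟩
    filter_upwards [hlim.eventually_lt_const (hlim_le.trans_lt ha)] with n hn
    exact (hupper n).trans_lt hn
  have hsq' : Tendsto (fun n => ‖un n - u‖ ^ 2) U (𝓝 0) := by
    have h := hsq.const_mul (mA - αφ * cφ ^ 2)⁻¹
    rw [mul_zero] at h
    exact h.congr fun n => inv_mul_cancel_left₀ hpos.ne' _
  rw [tendsto_iff_norm_sub_tendsto_zero]
  simpa using hsq'.sqrt
end
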